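/- arXiv:1802.09049 — 2 statements merged into one kernel-verified Lean document; each statement's English description precedes it below -/
import Mathlib

section
/- For all natural numbers k, s, n with 2 ≤ k ≤ s and 2·C(s+1,2) + 2s + 2 ≤ n (where C(s+1,2) = s(s+1)/2 is the binomial coefficient), there exists an n-vertex strongly s-connected tournament T whose diameter is at least (n − 2s)/C(s+1,2), and such that every strongly k-connected subtournament T' of T satisfies |V(T')| ≥ k·n/C(s+1,2) − k − 2. -/
/-- A digraph on the vertex type `V`, given by its adjacency (directed edge) relation. -/
structure Digr (V : Type) where
  Adj : V → V → Prop

namespace Digr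

variable {V : Type}

/-- No loops. -/
def Loopless (G : Digr V) : Prop := ∀ v, ¬ G.Adj v v

/-- A tournament: every pair of distinct vertices is joined by exactly one directed edge. -/
def IsTournament (G : Digr V) : Prop :=
  G.Loopless ∧ ∀ u v : V, u ≠ v → (G.Adj u v ↔ ¬ G.Adj v u)

/-- A semicomplete digraph: every pair of distinct vertices is joined by at least one
directed edge (edges in both directions are allowed). -/
def IsSemicomplete (G : Digr V) : Prop :=
  G.Loopless ∧ ∀ u v : V, u ≠ v → (G.Adj u v ∨ G.Adj v u)

/-- Out-neighbourhood `N⁺_G(v)`. -/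
def outN (G : Digr V) (v : V) : Set V := {u | G.Adj v u}

/-- In-neighbourhood `N⁻_G(v)`. -/
def inN (G : Digr V) (v : V) : Set V := {u | G.Adj u v}

/-- Union of two digraphs (on the same vertex type). -/
def union (G H : Digr V) : Digr V := ⟨fun a b => G.Adj a b ∨ H.Adj a b⟩

/-- `l` is a directed path of `G` lying inside the vertex set `A`, from `u` to `v`. -/
def IsPathOn (G : Digr V) (A : Set V) (u v : V) (l : List V) : Prop :=
  l.Nodup ∧ l.Chain' G.Adj ∧ (∀ x ∈ l, x ∈ A) ∧ l.head? = some u ∧ l.getLast? = some v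

/-- There is a directed path of `G` inside `A` from `u` to `v`. -/
def Reaches (G : Digr V) (A : Set V) (u v : V) : Prop :=
  ∃ l, G.IsPathOn A u v l

/-- The induced subdigraph of `G` on `W` is strongly `k`-connected: `|W| ≥ k + 1` and for
every ordered pair of distinct vertices of `W` and every `S ⊆ W ∖ {u,v}` with `|S| ≤ k - 1`
there is a directed path from `u` to `v` avoiding `S`. -/
def StronglyConnOn (G : Digr V) (W : Set V) (k : ℕ) : Prop :=
  k + 1 ≤ W.ncard ∧
  ∀ u ∈ W, ∀ v ∈ W, u ≠ v → ∀ S : Set V, S ⊆ W \ {u, v} → S.ncard < k →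
    G.Reaches (W \ S) u v

/-- Strong `c`-connectedness for a real parameter `c` (the condition on the removed set `S`
is `|S| ≤ c - 1`). -/
def StronglyConnOnR (G : Digr V) (W : Set V) (c : ℝ) : Prop :=
  c + 1 ≤ (W.ncard : ℝ) ∧
  ∀ u ∈ W, ∀ v ∈ W, u ≠ v → ∀ S : Set V, S ⊆ W \ {u, v} → (S.ncard : ℝ) ≤ c - 1 →
    G.Reaches (W \ S) u v

/-- `l` is a directed cycle of `G` (length at least 3) whose vertex set is `C`. -/
def IsCycleOn (G : Digr V) (C : Set V) (l : List V) : Prop :=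
  3 ≤ l.length ∧ l.Nodup ∧ (∀ x, x ∈ l ↔ x ∈ C) ∧ l.Chain' G.Adj ∧
  ∃ a b, l.getLast? = some a ∧ l.head? = some b ∧ G.Adj a b

/-- The pair `(v, U)` is `k`-connected in the induced subdigraph of `G` on `A`: after
deleting any `S ⊆ A ∖ {v}` with `|S| ≤ k - 1` there is a path from `v` to some vertex
of `U ∖ S` inside `A ∖ S`. -/
def VtxSetConn (G : Digr V) (A : Set V) (v : V) (U : Set V) (k : ℕ) : Prop :=
  ∀ S : Set V, S ⊆ A \ {v} → S.ncard < k → ∃ u ∈ U \ S, G.Reaches (A \ S) v u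

/-- The pair `(U, v)` is `k`-connected in the induced subdigraph of `G` on `A`. -/
def SetVtxConn (G : Digr V) (A : Set V) (U : Set V) (v : V) (k : ℕ) : Prop :=
  ∀ S : Set V, S ⊆ A \ {v} → S.ncard < k → ∃ u ∈ U \ S, G.Reaches (A \ S) u v

end Digr

open Digr

namespace Digr

variable {V : Type} {G : Digr V} {A : Set V}

theorem IsPathOn.invariant {u v : V} {l : List V} (hl : G.IsPathOn A u v l) (P : V → Prop)
    (hu : P u) (hstep : ∀ x ∈ A, ∀ y ∈ A, P x → G.Adj x y → P y) : P v := by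
  obtain ⟨-, hc, hA, hh, hlast⟩ := hl
  induction l generalizing u with
  | nil => simp at hh
  | cons a l ih =>
    obtain rfl : a = u := by simpa using hh
    cases l with
    | nil =>
      obtain rfl : a = v := by simpa using hlast
      exact hu
    | cons b l =>
      have hc' := List.isChain_cons_cons.1 hc
      refine ih (u := b) (hstep a (hA a (by simp)) b (hA b (by simp)) hu hc'.1) hc'.2
        (fun x hx => hA x (List.mem_cons_of_mem _ hx)) rfl ?_
      rwa [List.getLast?_cons_cons] at hlast

/-- One step along an edge of `G` inside `A`. -/
def StepIn (G : Digr V) (A : Set V) (x y : V) : Prop := x ∈ A ∧ y ∈ A ∧ G.Adj x y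

theorem reaches_of_reflTransGen {u v : V} (hu : u ∈ A)
    (h : Relation.ReflTransGen (G.StepIn A) u v) :
    G.Reaches A u v := by
  have hv : v ∈ A := by
    rcases h.cases_tail with rfl | ⟨c, -, hc⟩
    exacts [hu, hc.2.1]
  clear hu
  induction h using Relation.ReflTransGen.head_induction_on with
  | refl => exact ⟨[v], by simp, by simp [List.Chain'], by simpa using hv, rfl, rfl⟩
  | @head a c hac _ ih =>
    obtain ⟨l, hnd, hc, hA, hh, hlast⟩ := ih
    by_cases hal : a ∈ l
    · obtain ⟨l₁, l₂, rfl⟩ := List.append_of_mem hal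
      refine ⟨a :: l₂, hnd.sublist (List.sublist_append_right _ _),
        List.IsChain.right_of_append hc, fun x hx => hA x (List.mem_append_right _ hx), rfl, ?_⟩
      rwa [List.getLast?_append_of_ne_nil _ (by simp)] at hlast
    · cases l with
      | nil => simp at hh
      | cons b l =>
        obtain rfl : b = c := by simpa using hh
        refine ⟨a :: b :: l, List.nodup_cons.2 ⟨hal, hnd⟩,
          List.isChain_cons_cons.2 ⟨hac.2.2, hc⟩, ?_, rfl, ?_⟩
        · intro x hx
          rcases List.mem_cons.1 hx with rfl | hx
          exacts [hac.1, hA x hx]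
        · rwa [List.getLast?_cons_cons]

theorem StronglyConnOn.exists_mem_ne_ne {W : Set V} {k : ℕ} (hk : 2 ≤ k)
    (hW : G.StronglyConnOn W k) (x y : V) : ∃ v ∈ W, v ≠ x ∧ v ≠ y := by
  by_contra! h
  have hsub : W ⊆ {x, y} := fun v hv => by
    by_cases hx : v = x
    · simp [hx]
    · simp [h v hv hx]
  have := Set.ncard_le_ncard hsub (Set.toFinite _)
  have := Set.ncard_insert_le x {y}
  have := Set.ncard_singleton y
  have := hW.1
  omega

theorem StronglyConnOn.reaches_avoiding {W : Set V} {k : ℕ} (hk : 2 ≤ k)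
    (hW : G.StronglyConnOn W k) {u v x : V} (hu : u ∈ W) (hv : v ∈ W) (huv : u ≠ v) :
    G.Reaches (W \ ((W ∩ {x}) \ {u, v})) u v := by
  refine hW.2 u hu v hv huv _ (Set.sdiff_subset_sdiff_left Set.inter_subset_left) ?_
  have hsub : (W ∩ {x}) \ {u, v} ⊆ {x} := Set.sdiff_subset.trans Set.inter_subset_right
  have := Set.ncard_le_ncard hsub (Set.toFinite _)
  have := Set.ncard_singleton x
  omega

theorem StronglyConnOn.exists_adj_from {W : Set V} {k : ℕ} (hk : 2 ≤ k)
    (hW : G.StronglyConnOn W k) {w : V} (hw : w ∈ W) (x : V) :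
    ∃ y ∈ W, y ≠ w ∧ y ≠ x ∧ G.Adj w y := by
  by_contra! h
  obtain ⟨v, hv, hvw, hvx⟩ := hW.exists_mem_ne_ne hk w x
  obtain ⟨l, hl⟩ := hW.reaches_avoiding hk (x := x) hw hv hvw.symm
  refine hvw (hl.invariant (· = w) rfl ?_)
  rintro _ - y hy rfl hadj
  by_contra hyw
  have hyx : y ≠ x := by
    rintro rfl
    exact hy.2 ⟨⟨hy.1, rfl⟩, by simp [hyw, hvx.symm]⟩
  exact h y hy.1 hyw hyx hadj

theorem StronglyConnOn.exists_adj_to {W : Set V} {k : ℕ} (hk : 2 ≤ k)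
    (hW : G.StronglyConnOn W k) {w : V} (hw : w ∈ W) (x : V) :
    ∃ y ∈ W, y ≠ w ∧ y ≠ x ∧ G.Adj y w := by
  by_contra! h
  obtain ⟨v, hv, hvw, hvx⟩ := hW.exists_mem_ne_ne hk w x
  obtain ⟨l, hl⟩ := hW.reaches_avoiding hk (x := x) hv hw hvw
  refine hl.invariant (· ≠ w) hvw ?_ rfl
  rintro y hy _ - hyw hadj rfl
  have hyx : y ≠ x := by
    rintro rfl
    exact hy.2 ⟨⟨hy.1, rfl⟩, by simp [hyw, hvx.symm]⟩
  exact h y hy.1 hyw hyx hadj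

end Digr

theorem choose_two_succ (j : ℕ) : (j + 1).choose 2 = j.choose 2 + j := by
  rw [Nat.choose_succ_succ' j 1, Nat.choose_one_right, add_comm]

/-- The edges from the `s` lowest vertices into the first `(s + 1).choose 2` middle vertices:
vertex `u` dominates a block of `s - u` of them. -/
def Fan (s u v : ℕ) : Prop :=
  u < s ∧ s + (s - u).choose 2 ≤ v ∧ v < s + (s - u + 1).choose 2

theorem Fan.lt_add {s u v : ℕ} (h : Fan s u v) : v < s + (s + 1).choose 2 := by
  have := Nat.choose_le_choose 2 (show s - u + 1 ≤ s + 1 by omega)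
  have := h.2.2
  omega

theorem Fan.le {s u v : ℕ} (h : Fan s u v) : s ≤ v := by
  have := h.2.1
  omega

theorem Fan.not_lt {s u u' v : ℕ} (h : Fan s u v) (h' : Fan s u' v) : ¬ u < u' := by
  intro hlt
  have := h'.1
  have := Nat.choose_le_choose 2 (show s - u' + 1 ≤ s - u by omega)
  have := h.2.1
  have := h'.2.2
  omega

theorem Fan.left_unique {s u u' v : ℕ} (h : Fan s u v) (h' : Fan s u' v) : u = u' := by
  have := h.not_lt h'
  have := h'.not_lt h
  omega

/-- The edges directed from the smaller to the larger vertex. -/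
def ForwardEdge (s n u v : ℕ) : Prop :=
  Fan s u v ∨ (s ≤ u ∧ v = u + (s + 1).choose 2 ∧ v + s < n) ∨ Fan s (n - 1 - v) (n - 1 - u)

/-- All edges go from the larger to the smaller vertex, except for the forward edges. -/
def fanTournament (s n : ℕ) : Digr (Fin n) :=
  ⟨fun u v => ForwardEdge s n u v ∨ ((v : ℕ) < u ∧ ¬ ForwardEdge s n v u)⟩

section

variable {s n : ℕ}

theorem ForwardEdge.lt (hs : 0 < s) {u v : ℕ} (h : ForwardEdge s n u v) : u < v := by
  have := choose_two_succ s
  rcases h with h | h | h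
  · have := h.le
    have := h.1
    omega
  · omega
  · have := h.le
    have := h.1
    omega

theorem forwardEdge_rev {u v : ℕ} (hu : u < n) (hv : v < n) :
    ForwardEdge s n (n - 1 - v) (n - 1 - u) ↔ ForwardEdge s n u v := by
  unfold ForwardEdge
  rw [show n - 1 - (n - 1 - u) = u by omega, show n - 1 - (n - 1 - v) = v by omega]
  constructor
  · rintro (h | h | h)
    · exact .inr (.inr h)
    · exact .inr (.inl (by omega))
    · exact .inl h
  · rintro (h | h | h)
    · exact .inr (.inr h)
    · exact .inr (.inl (by omega))
    · exact .inl h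

theorem ForwardEdge.right_unique {u v v' : ℕ} (hu : s ≤ u) (hv : v < n) (hv' : v' < n)
    (h : ForwardEdge s n u v) (h' : ForwardEdge s n u v') : v = v' := by
  rcases h with h | h | h
  · have := h.1
    omega
  · rcases h' with h' | h' | h'
    · have := h'.1
      omega
    · omega
    · have := h'.lt_add
      omega
  · rcases h' with h' | h' | h'
    · have := h'.1
      omega
    · have := h.lt_add
      omega
    · have := h.left_unique h'
      omega

theorem ForwardEdge.left_unique {u u' v : ℕ} (hu : u < n) (hu' : u' < n) (hv : v + s < n)
    (h : ForwardEdge s n u v) (h' : ForwardEdge s n u' v) : u = u' := by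
  have := ForwardEdge.right_unique (v := n - 1 - u) (v' := n - 1 - u') (by omega) (by omega)
    (by omega) ((forwardEdge_rev hu (by omega)).2 h) ((forwardEdge_rev hu' (by omega)).2 h')
  omega

theorem ForwardEdge.lt_add {c u v : ℕ} (hc : s ≤ c) (hcn : c + (s + 1).choose 2 + s ≤ n)
    (h : ForwardEdge s n u v) (hu : u < c) : v < c + (s + 1).choose 2 := by
  rcases h with h | h | h
  · have := h.lt_add
    omega
  · omega
  · have := h.lt_add
    omega

theorem ForwardEdge.fan (hn : 2 * (s + 1).choose 2 + 2 * s + 2 ≤ n) {u v : ℕ} (hu : u < s)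
    (h : ForwardEdge s n u v) : Fan s u v := by
  rcases h with h | h | h
  · exact h
  · omega
  · have := h.lt_add
    omega

theorem fanTournament_adj {u v : Fin n} :
    (fanTournament s n).Adj u v ↔
      ForwardEdge s n u v ∨ ((v : ℕ) < u ∧ ¬ ForwardEdge s n v u) :=
  Iff.rfl

theorem fanTournament_adj_rev {u v : Fin n} :
    (fanTournament s n).Adj v.rev u.rev ↔ (fanTournament s n).Adj u v := by
  have hu := u.isLt
  have hv := v.isLt
  have e (w : Fin n) : ((w.rev : Fin n) : ℕ) = n - 1 - w := by
    rw [Fin.val_rev]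
    omega
  rw [fanTournament_adj, fanTournament_adj, e, e, forwardEdge_rev hu hv, forwardEdge_rev hv hu]
  have : n - 1 - (u : ℕ) < n - 1 - v ↔ (v : ℕ) < u := by omega
  rw [this]

theorem fanTournament_isTournament (hs : 0 < s) : (fanTournament s n).IsTournament := by
  refine ⟨fun v hv => ?_, fun u v huv => ?_⟩
  · rcases hv with hv | hv
    · exact lt_irrefl _ (hv.lt hs)
    · exact lt_irrefl _ hv.1
  · have huv' : (u : ℕ) ≠ v := fun h => huv (Fin.ext h)
    have h₁ : ForwardEdge s n u v → (u : ℕ) < v := ForwardEdge.lt hs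
    have h₂ : ForwardEdge s n v u → (v : ℕ) < u := ForwardEdge.lt hs
    rw [fanTournament_adj, fanTournament_adj]
    by_cases p : ForwardEdge s n u v <;> by_cases q : ForwardEdge s n v u <;>
      simp only [p, q, true_or, false_or, not_true, not_false_iff, and_true, and_false,
        true_iff, forall_const] at h₁ h₂ ⊢ <;> omega

theorem fanTournament_lt_add {c : ℕ} {u v : Fin n} (hc : s ≤ c)
    (hcn : c + (s + 1).choose 2 + s ≤ n) (h : (fanTournament s n).Adj u v) (hu : (u : ℕ) < c) :
    (v : ℕ) < c + (s + 1).choose 2 := by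
  rcases h with h | h
  · exact h.lt_add hc hcn hu
  · omega

theorem fanTournament_getLast_lt {u v : Fin n} {l : List (Fin n)} {c : ℕ} (hc : s ≤ c)
    (hcn : c + (l.length - 1) * (s + 1).choose 2 + s ≤ n) (hu : (u : ℕ) < c)
    (hl : l.IsChain (fanTournament s n).Adj) (hh : l.head? = some u)
    (hlast : l.getLast? = some v) : (v : ℕ) < c + (l.length - 1) * (s + 1).choose 2 := by
  induction l generalizing u c with
  | nil => simp at hh
  | cons a l ih =>
    obtain rfl : a = u := by simpa using hh
    cases l with
    | nil =>
      obtain rfl : a = v := by simpa using hlast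
      simpa using hu
    | cons b l =>
      have hl' := List.isChain_cons_cons.1 hl
      have e : ((a :: b :: l).length - 1) * (s + 1).choose 2
          = (s + 1).choose 2 + ((b :: l).length - 1) * (s + 1).choose 2 := by
        simp only [List.length_cons, Nat.add_sub_cancel]
        ring
      rw [e] at hcn ⊢
      rw [List.getLast?_cons_cons] at hlast
      rw [← add_assoc]
      exact ih (by omega) (by omega)
        (fanTournament_lt_add hc (by omega) hl'.1 hu) hl'.2 rfl hlast

theorem fanTournament_length_ge (hs : 0 < s) {u v : Fin n} (hu : (u : ℕ) = 0) (hv : (v : ℕ) = n - 1)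
    {l : List (Fin n)} (hl : (fanTournament s n).IsPathOn Set.univ u v l) :
    ((n : ℝ) - 2 * s) / ((s + 1).choose 2 : ℕ) ≤ (l.length : ℝ) - 1 := by
  obtain ⟨-, hc, -, hh, hlast⟩ := hl
  have hN : 0 < (s + 1).choose 2 := Nat.choose_pos (by omega)
  have hpos : 1 ≤ l.length := by
    rcases l with _ | ⟨a, l⟩
    · simp at hh
    · simp
  have key : n < s + (l.length - 1) * (s + 1).choose 2 + s := by
    by_contra! h
    have := fanTournament_getLast_lt le_rfl h (by omega) hc hh hlast
    omega
  have key' : (n : ℝ) < s + ((l.length : ℝ) - 1) * ((s + 1).choose 2 : ℕ) + s := by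
    have : ((l.length - 1 : ℕ) : ℝ) = (l.length : ℝ) - 1 := by
      rw [Nat.cast_sub hpos, Nat.cast_one]
    rw [← this]
    exact_mod_cast key
  rw [div_le_iff₀ (by exact_mod_cast hN)]
  linarith

theorem Digr.StronglyConnOn.exists_lt {W : Set (Fin n)} {k : ℕ} (hk : 2 ≤ k)
    (hW : (fanTournament s n).StronglyConnOn W k) : ∃ w ∈ W, (w : ℕ) < s := by
  by_contra! h
  have hne : W.Nonempty := Set.nonempty_of_ncard_ne_zero (by have := hW.1; omega)
  obtain ⟨w, hw, hmin⟩ := W.toFinite.exists_minimal hne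
  have hf : ∀ y ∈ W, (fanTournament s n).Adj w y → ForwardEdge s n w y := fun y hy hwy =>
    hwy.resolve_right fun hlt => absurd (hmin hy hlt.1.le) (not_le.2 hlt.1)
  obtain ⟨x, hx, -, -, hwx⟩ := hW.exists_adj_from hk hw w
  obtain ⟨y, hy, -, hyx, hwy⟩ := hW.exists_adj_from hk hw x
  exact hyx (Fin.ext (ForwardEdge.right_unique (h w hw) y.isLt x.isLt (hf y hy hwy)
    (hf x hx hwx)))

theorem Digr.StronglyConnOn.exists_ge {W : Set (Fin n)} {k : ℕ} (hk : 2 ≤ k)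
    (hW : (fanTournament s n).StronglyConnOn W k) : ∃ w ∈ W, n ≤ (w : ℕ) + s := by
  by_contra! h
  have hne : W.Nonempty := Set.nonempty_of_ncard_ne_zero (by have := hW.1; omega)
  obtain ⟨w, hw, hmax⟩ := W.toFinite.exists_maximal hne
  have hf : ∀ y ∈ W, (fanTournament s n).Adj y w → ForwardEdge s n y w := fun y hy hwy =>
    hwy.resolve_right fun hlt => absurd (hmax hy hlt.1.le) (not_le.2 hlt.1)
  obtain ⟨x, hx, -, -, hwx⟩ := hW.exists_adj_to hk hw w
  obtain ⟨y, hy, -, hyx, hwy⟩ := hW.exists_adj_to hk hw x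
  exact hyx (Fin.ext (ForwardEdge.left_unique y.isLt x.isLt (h w hw) (hf y hy hwy)
    (hf x hx hwx)))

theorem Digr.StronglyConnOn.le_ncard_layer {W : Set (Fin n)} {k : ℕ}
    (hW : (fanTournament s n).StronglyConnOn W k) {u v : Fin n} (hu : u ∈ W) (hv : v ∈ W)
    {c : ℕ} (hc : s ≤ c) (hcn : c + (s + 1).choose 2 + s ≤ n) (huc : (u : ℕ) < c)
    (hvc : c + (s + 1).choose 2 ≤ v) :
    k ≤ (W ∩ {x | c ≤ (x : ℕ) ∧ (x : ℕ) < c + (s + 1).choose 2}).ncard := by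
  by_contra! h
  obtain ⟨l, hl⟩ := hW.2 u hu v hv (by rintro rfl; omega)
    (W ∩ {x | c ≤ (x : ℕ) ∧ (x : ℕ) < c + (s + 1).choose 2}) (by
      rintro x ⟨hxW, hx⟩
      refine ⟨hxW, ?_⟩
      rintro (rfl | rfl)
      · exact absurd hx.1 (by omega)
      · exact absurd hx.2 (by omega)) h
  have : (v : ℕ) < c := by
    refine hl.invariant (fun x => (x : ℕ) < c) huc fun x _ y hy hx hxy => ?_
    by_contra hyc
    exact hy.2 ⟨hy.1, not_lt.1 hyc, fanTournament_lt_add hc hcn hxy hx⟩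
  omega

theorem Digr.StronglyConnOn.mul_le_ncard {W : Set (Fin n)} {k t : ℕ} (hk : 2 ≤ k)
    (hW : (fanTournament s n).StronglyConnOn W k)
    (ht : s + t * (s + 1).choose 2 + s ≤ n) : k * t + 2 ≤ W.ncard := by
  obtain ⟨u, hu, hus⟩ := hW.exists_lt hk
  obtain ⟨v, hv, hvs⟩ := hW.exists_ge hk
  have key : ∀ i ≤ t, k * i + 1 ≤ (W ∩ {x | (x : ℕ) < s + i * (s + 1).choose 2}).ncard := by
    intro i hi
    induction i with
    | zero => exact (Set.ncard_pos).2 ⟨u, hu, by simpa using hus⟩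
    | succ i ih =>
      have hit : (i + 1) * (s + 1).choose 2 ≤ t * (s + 1).choose 2 :=
        Nat.mul_le_mul_right _ hi
      have e : s + (i + 1) * (s + 1).choose 2
          = s + i * (s + 1).choose 2 + (s + 1).choose 2 := by ring
      have hlayer := hW.le_ncard_layer hu hv (c := s + i * (s + 1).choose 2) (by omega)
        (by omega) (by omega) (by omega)
      have hdisj : Disjoint (W ∩ {x | (x : ℕ) < s + i * (s + 1).choose 2})
          (W ∩ {x | s + i * (s + 1).choose 2 ≤ (x : ℕ) ∧
            (x : ℕ) < s + i * (s + 1).choose 2 + (s + 1).choose 2}) :=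
        Set.disjoint_left.2 fun x hx hx' => absurd hx.2 (not_lt.2 hx'.2.1)
      have hle := Set.ncard_le_ncard (t := W ∩ {x | (x : ℕ) < s + (i + 1) * (s + 1).choose 2})
        (Set.union_subset
          (fun x hx => (⟨hx.1, by have := hx.2; simp only [Set.mem_ofPred_eq] at this ⊢; omega⟩ :
            x ∈ W ∩ {x | (x : ℕ) < s + (i + 1) * (s + 1).choose 2}))
          (fun x hx => (⟨hx.1, by have := hx.2.2; simp only [Set.mem_ofPred_eq] at this ⊢; omega⟩ :
            x ∈ W ∩ {x | (x : ℕ) < s + (i + 1) * (s + 1).choose 2}))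
          : (W ∩ {x | (x : ℕ) < s + i * (s + 1).choose 2}) ∪
          (W ∩ {x | s + i * (s + 1).choose 2 ≤ (x : ℕ) ∧
            (x : ℕ) < s + i * (s + 1).choose 2 + (s + 1).choose 2}) ⊆ _)
      rw [Set.ncard_union_eq hdisj] at hle
      have := ih (by omega)
      rw [mul_add]
      omega
  have hlt : (W ∩ {x | (x : ℕ) < s + t * (s + 1).choose 2}).ncard < W.ncard :=
    Set.ncard_lt_ncard ⟨Set.inter_subset_left, fun h => absurd (h hv).2 (by
      simp only [Set.mem_ofPred_eq]
      omega)⟩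
  have := key t le_rfl
  omega

theorem Digr.StronglyConnOn.ncard_ge {W : Set (Fin n)} {k : ℕ} (hk : 2 ≤ k) (hks : k ≤ s)
    (hn : 2 * s ≤ n) (hW : (fanTournament s n).StronglyConnOn W k) :
    (k : ℝ) * n / ((s + 1).choose 2 : ℕ) - k - 2 ≤ (W.ncard : ℝ) := by
  have hN : 0 < (s + 1).choose 2 := Nat.choose_pos (by omega)
  obtain ⟨N, hNdef⟩ : ∃ N, N = (s + 1).choose 2 := ⟨_, rfl⟩
  have hN2 : 2 * (N : ℝ) = (s + 1) * s := by
    rw [hNdef, Nat.cast_choose_two]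
    push_cast
    ring
  have hcard := hW.mul_le_ncard hk (t := (n - 2 * s) / (s + 1).choose 2) (by
    have := Nat.div_mul_le_self (n - 2 * s) ((s + 1).choose 2)
    omega)
  have hdiv := Nat.lt_div_mul_add (a := n - 2 * s) hN
  rw [← hNdef] at hcard hdiv hN ⊢
  obtain ⟨t, ht⟩ : ∃ t, t = (n - 2 * s) / N := ⟨_, rfl⟩
  rw [← ht] at hcard hdiv
  have hdiv' : (n : ℝ) ≤ t * N + N + 2 * s := by
    have : n ≤ t * N + N + 2 * s := by omega
    exact_mod_cast this
  have hcard' : (k : ℝ) * t + 2 ≤ W.ncard := by exact_mod_cast hcard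
  have hks' : (k : ℝ) ≤ s := by exact_mod_cast hks
  have hkn : (k : ℝ) * n ≤ (k * t + k + 4) * N := by
    have h₁ : (k : ℝ) * n ≤ k * (t * N + N + 2 * s) := by gcongr
    have h₂ : (k : ℝ) * s ≤ s * s := by gcongr
    have h₃ : (0 : ℝ) ≤ s := by positivity
    nlinarith
  have := (div_le_iff₀ (by exact_mod_cast hN : (0 : ℝ) < N)).2 hkn
  linarith

theorem exists_forall_ne_of_ncard_compl_lt {A : Set (Fin n)} (hA : Aᶜ.ncard < s)
    (f : Fin n → ℕ) {T : Finset ℕ} (hT : s ≤ T.card) : ∃ t ∈ T, ∀ x ∉ A, f x ≠ t := by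
  by_contra! h
  have hsub : (T : Set ℕ) ⊆ f '' Aᶜ := fun t ht => by
    obtain ⟨x, hx, rfl⟩ := h t ht
    exact ⟨x, hx, rfl⟩
  have h₁ := Set.ncard_le_ncard hsub (Set.toFinite _)
  have h₂ := Set.ncard_image_le (f := f) (Set.toFinite Aᶜ)
  rw [Set.ncard_coe_finset] at h₁
  omega

theorem exists_path_from_lowest {A : Set (Fin n)} (hA : Aᶜ.ncard < s) {a : Fin n}
    (has : (a : ℕ) < s) (haA : a ∈ A) (hmin : ∀ x ∈ A, a ≤ x) :
    ∃ r : ℤ, ∀ x : Fin n, s ≤ (x : ℕ) → (x : ℕ) + s < n →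
      ((s + 1).choose 2 : ℤ) ∣ (x : ℤ) - r →
        x ∈ A ∧ Relation.ReflTransGen ((fanTournament s n).StepIn A) a x := by
  have hj := choose_two_succ (s - a)
  obtain ⟨t, ht, hne⟩ := exists_forall_ne_of_ncard_compl_lt hA
    (fun q => if (q : ℕ) < s then (q : ℕ) else s + ((q : ℕ) - s) % (s + 1).choose 2)
    (T := Finset.range a ∪ Finset.Ico (s + (s - a).choose 2) (s + (s - a + 1).choose 2)) (by
      rw [Finset.card_union_of_disjoint, Finset.card_range, Nat.card_Ico]
      · omega
      · refine Finset.disjoint_left.2 fun x hx hx' => ?_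
        simp only [Finset.mem_range, Finset.mem_Ico] at hx hx'
        omega)
  have hfan : Fan s a t := by
    rcases Finset.mem_union.1 ht with ht | ht
    · have hta := Finset.mem_range.1 ht
      refine absurd ?_ (hne ⟨t, by omega⟩ fun h => ?_)
      · simp only
        rw [if_pos (by omega)]
      · exact absurd (hmin _ h) (not_le.2 hta)
    · have := Finset.mem_Ico.1 ht
      exact ⟨has, this.1, this.2⟩
  have htN := hfan.lt_add
  have hst := hfan.le
  have hmem : ∀ i (hi : t + i * (s + 1).choose 2 + s < n),
      (⟨t + i * (s + 1).choose 2, by omega⟩ : Fin n) ∈ A := by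
    intro i hi
    by_contra hnot
    refine hne _ hnot ?_
    simp only
    rw [if_neg (by omega), show t + i * (s + 1).choose 2 - s
      = (t - s) + i * (s + 1).choose 2 by omega, Nat.add_mul_mod_self_right,
      Nat.mod_eq_of_lt (by omega)]
    omega
  have walk : ∀ i (hi : t + i * (s + 1).choose 2 + s < n),
      Relation.ReflTransGen ((fanTournament s n).StepIn A) a
        ⟨t + i * (s + 1).choose 2, by omega⟩ := by
    intro i hi
    induction i with
    | zero =>
      exact .single ⟨haA, hmem 0 hi, .inl (.inl (by simpa using hfan))⟩
    | succ i ih =>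
      have e : t + (i + 1) * (s + 1).choose 2
          = t + i * (s + 1).choose 2 + (s + 1).choose 2 := by ring
      have hi' : t + i * (s + 1).choose 2 + s < n := by omega
      exact (ih hi').tail ⟨hmem i hi', hmem (i + 1) hi,
        .inl (.inr (.inl ⟨by simp only; omega, e, by simp only; omega⟩))⟩
  refine ⟨t, fun x hx hxn ⟨z, hz⟩ => ?_⟩
  have hz0 : 0 ≤ z := by
    by_contra! hneg
    have : ((s + 1).choose 2 : ℤ) * z ≤ ((s + 1).choose 2 : ℤ) * (-1) :=
      mul_le_mul_of_nonneg_left (by omega) (by positivity)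
    omega
  obtain ⟨i, rfl⟩ := Int.eq_ofNat_of_zero_le hz0
  have hxi : (x : ℕ) = t + i * (s + 1).choose 2 := by
    have : (x : ℤ) = t + i * ((s + 1).choose 2 : ℕ) := by linarith
    exact_mod_cast this
  have hx_eq : x = ⟨t + i * (s + 1).choose 2, by omega⟩ := Fin.ext hxi
  rw [hx_eq]
  exact ⟨hmem i (by omega), walk i (by omega)⟩

theorem reflTransGen_lowest (hn : 2 * (s + 1).choose 2 + 2 * s + 2 ≤ n) {A : Set (Fin n)}
    (hA : Aᶜ.ncard < s) {a : Fin n} (has : (a : ℕ) < s) (haA : a ∈ A) (hmin : ∀ x ∈ A, a ≤ x)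
    {u : Fin n} (hu : u ∈ A) :
    Relation.ReflTransGen ((fanTournament s n).StepIn A) u a := by
  have hN : 0 < (s + 1).choose 2 := Nat.choose_pos (by omega)
  have direct : ∀ x ∈ A, x ≠ a → ¬ ForwardEdge s n a x →
      (fanTournament s n).StepIn A x a := fun x hx hxa hf =>
    ⟨hx, haA, .inr ⟨lt_of_le_of_ne (hmin x hx) (Fin.val_ne_of_ne hxa.symm), hf⟩⟩
  rcases eq_or_ne u a with rfl | hua
  · exact .refl
  by_cases hf : ForwardEdge s n a u
  swap
  · exact .single (direct u hu hua hf)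
  have hfan := hf.fan hn has
  have hus := hfan.le
  have huN := hfan.lt_add
  by_cases hnext : (⟨u + (s + 1).choose 2, by omega⟩ : Fin n) ∈ A
  · refine .head ⟨hu, hnext, .inl (.inr (.inl ⟨hus, rfl, by simp only; omega⟩))⟩
      (.single (direct _ hnext ?_ ?_))
    · intro h
      have := congrArg Fin.val h
      simp only at this
      omega
    · intro h
      have := (h.fan hn has).lt_add
      simp only at this
      omega
  · obtain ⟨t, ht, hne⟩ := exists_forall_ne_of_ncard_compl_lt hA (fun q => (q : ℕ))
      (T := insert ((u : ℕ) + (s + 1).choose 2) ((Finset.range s).erase a)) (by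
        rw [Finset.card_insert_of_notMem, Finset.card_erase_of_mem, Finset.card_range]
        · omega
        · simpa using has
        · simp only [Finset.mem_erase, Finset.mem_range]
          omega)
    rcases Finset.mem_insert.1 ht with rfl | ht
    · exact absurd rfl (hne _ hnext)
    · obtain ⟨hta, hts⟩ := Finset.mem_erase.1 ht
      rw [Finset.mem_range] at hts
      have htA : (⟨t, by omega⟩ : Fin n) ∈ A := by
        by_contra h
        exact hne _ h rfl
      refine .head ⟨hu, htA, .inr ⟨by simp only; omega, fun h => ?_⟩⟩
        (.single (direct _ htA (fun h => hta (congrArg Fin.val h)) fun h => ?_))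
      · exact hta ((h.fan hn hts).left_unique hfan)
      · have := (h.fan hn has).le
        simp only at this
        omega

theorem exists_sink_with_path (hn : 2 * (s + 1).choose 2 + 2 * s + 2 ≤ n) {A : Set (Fin n)}
    (hA : Aᶜ.ncard < s) :
    ∃ a, (∀ u ∈ A, Relation.ReflTransGen ((fanTournament s n).StepIn A) u a) ∧
      ∃ r : ℤ, ∀ x : Fin n, s ≤ (x : ℕ) → (x : ℕ) + s < n →
        ((s + 1).choose 2 : ℤ) ∣ (x : ℤ) - r →
          x ∈ A ∧ Relation.ReflTransGen ((fanTournament s n).StepIn A) a x := by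
  obtain ⟨t, ht, hne⟩ := exists_forall_ne_of_ncard_compl_lt hA (fun q => (q : ℕ))
    (T := Finset.range s) (by simp)
  rw [Finset.mem_range] at ht
  have htA : (⟨t, by omega⟩ : Fin n) ∈ A := by
    by_contra h
    exact hne _ h rfl
  obtain ⟨a, haA, hmin⟩ := A.toFinite.exists_minimal ⟨_, htA⟩
  replace hmin : ∀ x ∈ A, a ≤ x := fun x hx => (le_total a x).elim id (fun h => hmin hx h)
  have has : (a : ℕ) < s := lt_of_le_of_lt (hmin _ htA) ht
  exact ⟨a, fun u hu => reflTransGen_lowest hn hA has haA hmin hu,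
    exists_path_from_lowest hA has haA hmin⟩

theorem reflTransGen_rev {A : Set (Fin n)} {u v : Fin n}
    (h : Relation.ReflTransGen ((fanTournament s n).StepIn (Fin.rev ⁻¹' A)) u v) :
    Relation.ReflTransGen ((fanTournament s n).StepIn A) v.rev u.rev :=
  (Relation.ReflTransGen.lift (p := Function.swap ((fanTournament s n).StepIn A)) Fin.rev
    (fun _ _ h => ⟨h.2.1, h.1, fanTournament_adj_rev.2 h.2.2⟩) _ _ h).swap

theorem exists_source_with_path (hn : 2 * (s + 1).choose 2 + 2 * s + 2 ≤ n) {A : Set (Fin n)}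
    (hA : Aᶜ.ncard < s) :
    ∃ b, (∀ u ∈ A, Relation.ReflTransGen ((fanTournament s n).StepIn A) b u) ∧
      ∃ r : ℤ, ∀ x : Fin n, s ≤ (x : ℕ) → (x : ℕ) + s < n →
        ((s + 1).choose 2 : ℤ) ∣ (x : ℤ) - r →
          x ∈ A ∧ Relation.ReflTransGen ((fanTournament s n).StepIn A) x b := by
  have hA' : (Fin.rev ⁻¹' A)ᶜ.ncard < s := by
    rw [← Set.preimage_compl, Set.ncard_preimage_of_injective_subset_range Fin.rev_injective
      (by simp [Fin.rev_surjective.range_eq])]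
    exact hA
  obtain ⟨a, ha, r, hr⟩ := exists_sink_with_path hn hA'
  refine ⟨a.rev, fun u hu => ?_, n - 1 - r, fun x hx hxn hdvd => ?_⟩
  · simpa using reflTransGen_rev (ha u.rev (by simpa using hu))
  · have hxr : ((x.rev : Fin n) : ℕ) = n - 1 - x := by
      rw [Fin.val_rev]
      omega
    obtain ⟨h₁, h₂⟩ := hr x.rev (by omega) (by omega) (by
      rw [show ((x.rev : ℕ) : ℤ) - r = -((x : ℤ) - (n - 1 - r)) by omega]
      exact (dvd_neg).2 hdvd)
    exact ⟨by simpa using h₁, by simpa using reflTransGen_rev h₂⟩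

theorem Int.exists_mem_Ico_dvd_sub {N : ℤ} (hN : 0 < N) (c r : ℤ) :
    ∃ x, c ≤ x ∧ x < c + N ∧ N ∣ x - r := by
  refine ⟨c + (r - c) % N, ?_, ?_, ?_⟩
  · have := Int.emod_nonneg (r - c) hN.ne'
    omega
  · have := Int.emod_lt_of_pos (r - c) hN
    omega
  · rw [show c + (r - c) % N - r = -((r - c) - (r - c) % N) by ring, dvd_neg]
    exact Int.dvd_self_sub_emod

theorem fanTournament_reflTransGen (hn : 2 * (s + 1).choose 2 + 2 * s + 2 ≤ n)
    {A : Set (Fin n)} (hA : Aᶜ.ncard < s) {u v : Fin n} (hu : u ∈ A) (hv : v ∈ A) :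
    Relation.ReflTransGen ((fanTournament s n).StepIn A) u v := by
  have hN : 0 < (s + 1).choose 2 := Nat.choose_pos (by omega)
  obtain ⟨a, ha, r, hr⟩ := exists_sink_with_path hn hA
  obtain ⟨b, hb, r', hr'⟩ := exists_source_with_path hn hA
  refine (ha u hu).trans (Relation.ReflTransGen.trans ?_ (hb v hv))
  obtain ⟨x, hx₁, hx₂, hx⟩ := Int.exists_mem_Ico_dvd_sub
    (by exact_mod_cast hN : (0 : ℤ) < ((s + 1).choose 2 : ℕ)) (n - s - (s + 1).choose 2 : ℤ) r
  obtain ⟨y, hy₁, hy₂, hy⟩ := Int.exists_mem_Ico_dvd_sub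
    (by exact_mod_cast hN : (0 : ℤ) < ((s + 1).choose 2 : ℕ)) (s : ℤ) r'
  lift x to ℕ using by omega
  lift y to ℕ using by omega
  obtain ⟨hxA, hax⟩ := hr ⟨x, by omega⟩ (by simp only; omega) (by simp only; omega) hx
  obtain ⟨hyA, hyb⟩ := hr' ⟨y, by omega⟩ (by simp only; omega) (by simp only; omega) hy
  by_cases hxy : x = y + (s + 1).choose 2
  · refine hax.trans (hr' ⟨x, by omega⟩ (by simp only; omega) (by simp only; omega) ?_).2
    rw [show ((x : ℕ) : ℤ) - r' = (y - r') + ((s + 1).choose 2 : ℕ) by omega]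
    exact dvd_add hy dvd_rfl
  · refine (hax.tail ⟨hxA, hyA, .inr ⟨by simp only; omega, fun h => ?_⟩⟩).trans hyb
    rcases h with h | h | h
    · have := h.1
      simp only at this
      omega
    · exact hxy h.2.1
    · have := h.1
      simp only at this
      omega

theorem fanTournament_stronglyConnOn (hn : 2 * (s + 1).choose 2 + 2 * s + 2 ≤ n) :
    (fanTournament s n).StronglyConnOn Set.univ s := by
  refine ⟨by rw [Set.ncard_univ, Nat.card_fin]; omega, fun u _ v _ _ S hS hcard => ?_⟩
  have hu : u ∈ Set.univ \ S := ⟨trivial, fun h => (hS h).2 (by simp)⟩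
  have hv : v ∈ Set.univ \ S := ⟨trivial, fun h => (hS h).2 (by simp)⟩
  refine reaches_of_reflTransGen hu (fanTournament_reflTransGen hn ?_ hu hv)
  rwa [← Set.compl_eq_univ_sdiff, compl_compl]

end

/-- **Proposition 1.2.** For `2 ≤ k ≤ s` and `2·C(s+1,2) + 2s + 2 ≤ n`, there exists an
`n`-vertex strongly `s`-connected tournament of diameter at least `(n - 2s)/C(s+1,2)`
in which every strongly `k`-connected subtournament has at least
`k·n/C(s+1,2) - k - 2` vertices. -/
theorem stmt2 (k s n : ℕ) (hk : 2 ≤ k) (hks : k ≤ s)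
    (hn : 2 * Nat.choose (s + 1) 2 + 2 * s + 2 ≤ n) :
    ∃ T : Digr (Fin n), T.IsTournament ∧ T.StronglyConnOn Set.univ s ∧
      (∃ u v : Fin n, u ≠ v ∧ ∀ l : List (Fin n), T.IsPathOn Set.univ u v l →
        ((n : ℝ) - 2 * s) / (Nat.choose (s + 1) 2) ≤ (l.length : ℝ) - 1) ∧
      (∀ W : Set (Fin n), T.StronglyConnOn W k →
        (k : ℝ) * n / (Nat.choose (s + 1) 2) - k - 2 ≤ (W.ncard : ℝ)) := by
  refine ⟨fanTournament s n, fanTournament_isTournament (by omega),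
    fanTournament_stronglyConnOn hn, ⟨⟨0, by omega⟩, ⟨n - 1, by omega⟩, ?_, fun l hl =>
      fanTournament_length_ge (by omega) rfl rfl hl⟩, fun W hW =>
    hW.ncard_ge hk hks (by omega)⟩
  intro h
  have := congrArg Fin.val h
  simp only at this
  omega
end

section
/- For every integer k ≥ 2 there are infinitely many minimally strongly k-connected tournaments; that is, for every N ∈ ℕ there exists a minimally strongly k-connected tournament on more than N vertices. -/
open Digr

namespace Digr

variable {V : Type}

/-- Reachability inside `A` in terms of the reflexive transitive closure of adjacency. -/
theorem reaches_iff {G : Digr V} {A : Set V} {u v : V} :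
    G.Reaches A u v ↔
      u ∈ A ∧ Relation.ReflTransGen (fun a b => G.Adj a b ∧ b ∈ A) u v := by
  constructor
  · rintro ⟨l, -, hc, hA, hh, hl⟩
    induction l generalizing u with
    | nil => simp at hh
    | cons x t ih =>
      obtain rfl : x = u := by simpa using hh
      refine ⟨hA x (by simp), ?_⟩
      cases t with
      | nil =>
        obtain rfl : x = v := by simpa using hl
        exact .refl
      | cons y s =>
        have hc' : G.Adj x y ∧ List.IsChain G.Adj (y :: s) := by
          simpa [List.Chain'] using hc
        have h := ih (u := y) hc'.2 (fun z hz => hA z (List.mem_cons_of_mem _ hz)) (by simp)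
          (by simpa using hl)
        exact .head ⟨hc'.1, h.1⟩ h.2
  · rintro ⟨hu, h⟩
    induction h using Relation.ReflTransGen.head_induction_on with
    | refl => exact ⟨[v], by simp [IsPathOn, List.Chain', hu]⟩
    | @head a b hab _ ih =>
      obtain ⟨l, hn, hc, hA, hh, hl⟩ := ih hab.2
      by_cases ha : a ∈ l
      · obtain ⟨s, t, rfl⟩ := List.append_of_mem ha
        refine ⟨a :: t, (List.nodup_append.1 hn).2.1, ?_, fun x hx => hA x (by simp_all),
          rfl, ?_⟩
        · exact (List.isChain_append.1 hc).2.1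
        · simpa [List.getLast?_append] using hl
      · refine ⟨a :: l, List.nodup_cons.2 ⟨ha, hn⟩, ?_, ?_, rfl, ?_⟩
        · cases l with
          | nil => simp at hh
          | cons y s =>
            obtain rfl : y = b := by simpa using hh
            exact List.isChain_cons_cons.2 ⟨hab.1, hc⟩
        · simpa [hu] using hA
        · cases l with
          | nil => simp at hh
          | cons y s => simpa using hl

theorem Reaches.single {G : Digr V} {A : Set V} {u v : V} (hu : u ∈ A) (hv : v ∈ A)
    (h : G.Adj u v) : G.Reaches A u v :=
  reaches_iff.2 ⟨hu, .single ⟨h, hv⟩⟩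

theorem Reaches.trans {G : Digr V} {A : Set V} {u v w : V} (h : G.Reaches A u v)
    (h' : G.Reaches A v w) : G.Reaches A u w :=
  reaches_iff.2 ⟨(reaches_iff.1 h).1, (reaches_iff.1 h).2.trans (reaches_iff.1 h').2⟩

/-- A path leaving `X` uses an edge leaving `X`. -/
theorem Reaches.exists_adj_of_mem_of_notMem {G : Digr V} {A X : Set V} {u v : V}
    (h : G.Reaches A u v) (hu : u ∈ X) (hv : v ∉ X) :
    ∃ a ∈ A, ∃ b ∈ A, a ∈ X ∧ b ∉ X ∧ G.Adj a b := by
  obtain ⟨huA, h'⟩ := reaches_iff.1 h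
  clear h
  induction h' using Relation.ReflTransGen.head_induction_on with
  | refl => exact absurd hu hv
  | @head a b hab _ ih =>
    by_cases hb : b ∈ X
    · exact ih hb hab.2
    · exact ⟨a, huA, b, hab.2, hu, hb, hab.1⟩

theorem StronglyConnOn.exists_adj {G : Digr V} {W S X : Set V} {k : ℕ} {u v : V}
    (h : G.StronglyConnOn W k) (hS : S ⊆ W) (hk : S.ncard < k)
    (hu : u ∈ W) (huS : u ∉ S) (huX : u ∈ X) (hv : v ∈ W) (hvS : v ∉ S) (hvX : v ∉ X) :
    ∃ a ∈ W \ S, ∃ b ∈ W \ S, a ∈ X ∧ b ∉ X ∧ G.Adj a b := by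
  refine (h.2 u hu v hv (by rintro rfl; exact hvX huX) S ?_ hk).exists_adj_of_mem_of_notMem huX hvX
  intro x hx
  refine ⟨hS hx, ?_⟩
  rintro (rfl | rfl) <;> contradiction

theorem StronglyConnOn.exists_notMem {G : Digr V} {W S : Set V} {k : ℕ}
    (h : G.StronglyConnOn W k) (hS : S.Finite) (hk : S.ncard < k) (x : V) :
    ∃ v ∈ W, v ∉ S ∧ v ≠ x := by
  have hc : (insert x S).ncard < W.ncard :=
    (Set.ncard_insert_le x S).trans_lt (by have := h.1; omega)
  obtain ⟨v, hv, hvS⟩ := Set.exists_mem_notMem_of_ncard_lt_ncard hc (hS.insert x)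
  exact ⟨v, hv, fun h => hvS (.inr h), fun h => hvS (.inl h)⟩

/-- Fewer than `k` vertices cannot contain all out-neighbours of a vertex. -/
theorem StronglyConnOn.exists_out {G : Digr V} {W S : Set V} {k : ℕ} {x : V}
    (h : G.StronglyConnOn W k) (hS : S.Finite) (hk : S.ncard < k) (hx : x ∈ W) (hxS : x ∉ S) :
    ∃ y ∈ W, y ∉ S ∧ G.Adj x y := by
  obtain ⟨v, hv, hvS, hvx⟩ := h.exists_notMem hS hk x
  obtain ⟨a, -, b, hb, rfl, -, hab⟩ := h.exists_adj (S := S ∩ W) (X := {x})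
    Set.inter_subset_right ((Set.ncard_le_ncard Set.inter_subset_left hS).trans_lt hk)
    hx (fun h => hxS h.1) rfl hv (fun h => hvS h.1) hvx
  exact ⟨b, hb.1, fun h => hb.2 ⟨h, hb.1⟩, hab⟩

/-- Fewer than `k` vertices cannot contain all in-neighbours of a vertex. -/
theorem StronglyConnOn.exists_in {G : Digr V} {W S : Set V} {k : ℕ} {x : V}
    (h : G.StronglyConnOn W k) (hS : S.Finite) (hk : S.ncard < k) (hx : x ∈ W) (hxS : x ∉ S) :
    ∃ y ∈ W, y ∉ S ∧ G.Adj y x := by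
  obtain ⟨v, hv, hvS, hvx⟩ := h.exists_notMem hS hk x
  obtain ⟨a, ha, b, -, -, hb, hab⟩ := h.exists_adj (S := S ∩ W) (X := {x}ᶜ)
    Set.inter_subset_right ((Set.ncard_le_ncard Set.inter_subset_left hS).trans_lt hk)
    hv (fun h => hvS h.1) hvx hx (fun h => hxS h.1) (by simp)
  obtain rfl : b = x := by simpa using hb
  exact ⟨a, ha.1, fun h => ha.2 ⟨h, ha.1⟩, hab⟩

/-- The pullback of a digraph along a map. -/
def comap {U : Type} (f : U → V) (G : Digr V) : Digr U := ⟨fun a b => G.Adj (f a) (f b)⟩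

theorem IsTournament.comap {U : Type} {f : U → V} (hf : f.Injective) {G : Digr V}
    (h : G.IsTournament) : (G.comap f).IsTournament :=
  ⟨fun v => h.1 (f v), fun _ _ huv => h.2 _ _ (hf.ne huv)⟩

theorem reaches_comap {U : Type} {f : U → V} (hf : f.Injective) {G : Digr V} {A : Set U}
    {u v : U} : (G.comap f).Reaches A u v ↔ G.Reaches (f '' A) (f u) (f v) := by
  rw [reaches_iff, reaches_iff, hf.mem_set_image]
  refine and_congr_right fun _ => ⟨fun h => h.lift f fun a b hab =>
    ⟨hab.1, Set.mem_image_of_mem f hab.2⟩, fun h => ?_⟩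
  suffices ∀ y, Relation.ReflTransGen (fun a b => G.Adj a b ∧ b ∈ f '' A) (f u) y →
      ∃ w, f w = y ∧ Relation.ReflTransGen (fun a b => (G.comap f).Adj a b ∧ b ∈ A) u w by
    obtain ⟨w, hw, h'⟩ := this _ h
    rwa [← hf hw]
  intro y hy
  induction hy with
  | refl => exact ⟨u, rfl, .refl⟩
  | tail _ hbc ih =>
    obtain ⟨w, rfl, hw⟩ := ih
    obtain ⟨hadj, c, hc, rfl⟩ := hbc
    exact ⟨c, rfl, hw.tail ⟨hadj, hc⟩⟩

theorem stronglyConnOn_comap {U : Type} {f : U → V} (hf : f.Injective) {G : Digr V} {W : Set U}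
    {k : ℕ} : (G.comap f).StronglyConnOn W k ↔ G.StronglyConnOn (f '' W) k := by
  unfold StronglyConnOn
  rw [Set.ncard_image_of_injective W hf]
  refine and_congr_right fun _ => ⟨?_, ?_⟩
  · rintro h _ ⟨u, hu, rfl⟩ _ ⟨v, hv, rfl⟩ huv S hS hk
    obtain ⟨S, rfl⟩ : ∃ S', S = f '' S' :=
      ⟨f ⁻¹' S, (Set.image_preimage_eq_of_subset fun x hx =>
        (Set.image_subset_range f W) (hS hx).1).symm⟩
    rw [← Set.image_sdiff hf, ← reaches_comap hf]
    rw [Set.ncard_image_of_injective S hf] at hk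
    refine h u hu v hv (fun h => huv (h ▸ rfl)) S ?_ hk
    rwa [← Set.image_pair, ← Set.image_sdiff hf, Set.image_subset_image_iff hf] at hS
  · intro h u hu v hv huv S hS hk
    rw [reaches_comap hf, Set.image_sdiff hf]
    refine h _ (Set.mem_image_of_mem f hu) _ (Set.mem_image_of_mem f hv) (hf.ne huv) _ ?_
      (by rwa [Set.ncard_image_of_injective S hf])
    rwa [← Set.image_pair, ← Set.image_sdiff hf, Set.image_subset_image_iff hf]

/-- A finite strongly `k`-connected set of vertices contains a minimal one, which is a minimally
strongly `k`-connected tournament in its own right. -/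
theorem exists_minimal_tournament {G : Digr V} (hG : G.IsTournament) {W₀ : Set V} {k N : ℕ}
    (hfin : W₀.Finite) (h₀ : G.StronglyConnOn W₀ k)
    (hN : ∀ W ⊆ W₀, G.StronglyConnOn W k → N < W.ncard) :
    ∃ n : ℕ, N < n ∧ ∃ T : Digr (Fin n), T.IsTournament ∧
      T.StronglyConnOn Set.univ k ∧
      ∀ W : Set (Fin n), W ≠ Set.univ → ¬ T.StronglyConnOn W k := by
  have hsub : {W | W ⊆ W₀ ∧ G.StronglyConnOn W k}.Finite :=
    hfin.finite_subsets.subset fun W hW => hW.1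
  obtain ⟨W, hW⟩ := hsub.exists_minimal ⟨W₀, subset_rfl, h₀⟩
  have hWfin := hfin.subset hW.1.1
  have : Finite W := hWfin
  let e : Fin W.ncard ≃ W := (Finite.equivFinOfCardEq (Nat.card_coe_set_eq W)).symm
  let f : Fin W.ncard → V := fun i => e i
  have hf : f.Injective := Subtype.val_injective.comp e.injective
  have hrange : Set.range f = W := by
    change Set.range (Subtype.val ∘ e) = W
    rw [e.surjective.range_comp, Subtype.range_coe]
  refine ⟨W.ncard, hN W hW.1.1 hW.1.2, G.comap f, hG.comap hf, ?_, fun X hX h => hX ?_⟩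
  · rw [stronglyConnOn_comap hf, Set.image_univ, hrange]
    exact hW.1.2
  · rw [stronglyConnOn_comap hf] at h
    have hXW : f '' X ⊆ W := (Set.image_subset_range f X).trans hrange.subset
    have := hW.2 ⟨hXW.trans hW.1.1, h⟩ hXW
    refine Set.eq_univ_of_forall fun i => (hf.mem_set_image).1 (this (e i).2)

/-- The edges of the ladder tournament that increase the level (the first coordinate). -/
def LadderUp (L : ℕ) (x y : ℕ × ℕ) : Prop :=
  (x.2 = y.2 ∧ y.1 = x.1 + 1 ∧ 1 ≤ x.1 ∧ x.1 + 2 ≤ L) ∨ (x.1 = 0 ∧ y.1 = 2) ∨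
    (x.1 + 2 = L ∧ y.1 = L)

/-- The ladder tournament: edges decrease in the lexicographic order, except for those joining
consecutive levels `1, …, L - 1` in the same column, and those from level `0` to level `2` and
from level `L - 2` to level `L`. -/
def ladder (L : ℕ) : Digr (ℕ × ℕ) :=
  ⟨fun x y => LadderUp L x y ∨ ((y.1 < x.1 ∨ (y.1 = x.1 ∧ y.2 < x.2)) ∧ ¬ LadderUp L y x)⟩

theorem ladder_adj {L a b c d : ℕ} : (ladder L).Adj (a, b) (c, d) ↔
    ((b = d ∧ c = a + 1 ∧ 1 ≤ a ∧ a + 2 ≤ L) ∨ (a = 0 ∧ c = 2) ∨ (a + 2 = L ∧ c = L)) ∨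
      ((c < a ∨ (c = a ∧ d < b)) ∧
        ¬ ((d = b ∧ a = c + 1 ∧ 1 ≤ c ∧ c + 2 ≤ L) ∨ (c = 0 ∧ a = 2) ∨ (c + 2 = L ∧ a = L))) :=
  Iff.rfl

theorem isTournament_ladder (L : ℕ) : (ladder L).IsTournament := by
  constructor
  · rintro ⟨a, b⟩ h
    simp only [ladder, LadderUp] at h
    omega
  · rintro ⟨a, b⟩ ⟨c, d⟩ h
    rw [Ne, Prod.mk.injEq] at h
    simp only [ladder, LadderUp]
    omega

/-- The vertices of the ladder with `L + 1` levels and `k` columns. -/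
def ladderVerts (L k : ℕ) : Set (ℕ × ℕ) := {x | x.1 ≤ L ∧ x.2 < k}

theorem ladderVerts_eq (L k : ℕ) :
    ladderVerts L k = ↑(Finset.range (L + 1) ×ˢ Finset.range k) := by
  ext ⟨a, b⟩
  simp [ladderVerts]

theorem finite_ladderVerts (L k : ℕ) : (ladderVerts L k).Finite := by
  rw [ladderVerts_eq]
  exact Finset.finite_toSet _

theorem stronglyConnOn_ladder {L k : ℕ} (hL : 6 ≤ L) (hk : 2 ≤ k) :
    (ladder L).StronglyConnOn (ladderVerts L k) k := by
  constructor
  · rw [ladderVerts_eq, Set.ncard_coe_finset, Finset.card_product, Finset.card_range,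
      Finset.card_range]
    nlinarith
  · intro u hu v hv _ S hS hSk
    have hSfin : S.Finite := (finite_ladderVerts L k).subset fun x hx => (hS hx).1
    have huS : u ∉ S := fun h => (hS h).2 (by simp)
    have hvS : v ∉ S := fun h => (hS h).2 (by simp)
    obtain ⟨r, hr, hrS⟩ : ∃ r < k, ∀ q, (q, r) ∉ S := by
      by_contra! hcon
      have hsub : (↑(Finset.range k) : Set ℕ) ⊆ Prod.snd '' S := fun r hr => by
        obtain ⟨q, hq⟩ := hcon r (by simpa using hr)
        exact ⟨_, hq, rfl⟩
      have h1 := Set.ncard_le_ncard hsub (hSfin.image _)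
      have h2 := Set.ncard_image_le (f := Prod.snd) hSfin
      rw [Set.ncard_coe_finset, Finset.card_range] at h1
      omega
    set A := ladderVerts L k \ S
    have hcol : ∀ q ≤ L, (q, r) ∈ A := fun q hq => ⟨⟨hq, hr⟩, hrS q⟩
    have huA : u ∈ A := ⟨hu, huS⟩
    have hvA : v ∈ A := ⟨hv, hvS⟩
    have hstep : ∀ p q, p ≤ L → q ≤ L → (ladder L).Adj (p, r) (q, r) →
        (ladder L).Reaches A (p, r) (q, r) :=
      fun p q hp hq h => .single (hcol p hp) (hcol q hq) h
    have hup : ∀ q, q + 4 ≤ L → (ladder L).Reaches A (0, r) (q + 2, r) := by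
      intro q hq
      induction q with
      | zero => exact hstep _ _ (by omega) (by omega) (by rw [ladder_adj]; omega)
      | succ q ih =>
        refine (ih (by omega)).trans (hstep _ _ (by omega) (by omega) ?_)
        rw [ladder_adj]; omega
    have hlong : (ladder L).Reaches A (0, r) (L, r) := by
      obtain ⟨M, rfl⟩ : ∃ M, L = M + 4 := ⟨L - 4, by omega⟩
      refine (hup M (by omega)).trans (hstep _ _ (by omega) (by omega) ?_)
      rw [ladder_adj]; omega
    have hdown : ∀ q, 3 ≤ q → q ≤ L → (ladder L).Reaches A (q, r) (0, r) := fun q h3 hq =>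
      hstep _ _ hq (by omega) (by rw [ladder_adj]; omega)
    have hdown' : ∀ q, q + 3 ≤ L → (ladder L).Reaches A (L, r) (q, r) := fun q hq =>
      hstep _ _ le_rfl (by omega) (by rw [ladder_adj]; omega)
    have htwo : (ladder L).Reaches A (2, r) (0, r) :=
      (hstep 2 3 (by omega) (by omega) (by rw [ladder_adj]; omega)).trans
        (hdown 3 le_rfl (by omega))
    have htwo' : (ladder L).Reaches A (L, r) (L - 2, r) :=
      (hdown' (L - 3) (by omega)).trans (hstep _ _ (by omega) (by omega)
        (by rw [ladder_adj]; omega))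
    have hto : (ladder L).Reaches A u (0, r) := by
      obtain ⟨q, c⟩ := u
      obtain ⟨hq : q ≤ L, -⟩ := hu
      by_cases h0 : q = 0
      · refine (Reaches.single huA (hcol 2 (by omega)) ?_).trans htwo
        rw [ladder_adj]; omega
      by_cases h2 : q = 2
      · by_cases hc : c = r
        · rw [h2, hc]; exact htwo
        · refine (Reaches.single huA (hcol 1 (by omega)) ?_).trans
            (hstep 1 0 (by omega) (by omega) ?_) <;>
          · rw [ladder_adj]; omega
      · refine Reaches.single huA (hcol 0 (by omega)) ?_
        rw [ladder_adj]; omega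
    have hfrom : (ladder L).Reaches A (L, r) v := by
      obtain ⟨q, c⟩ := v
      obtain ⟨hq : q ≤ L, -⟩ := hv
      by_cases h0 : q = L
      · refine htwo'.trans (Reaches.single (hcol _ (by omega)) hvA ?_)
        rw [ladder_adj]; omega
      by_cases h2 : q + 2 = L
      · by_cases hc : c = r
        · obtain rfl : q = L - 2 := by omega
          rw [hc]; exact htwo'
        · refine (hstep L (L - 1) (by omega) (by omega) ?_).trans
            (Reaches.single (hcol _ (by omega)) hvA ?_) <;>
          · rw [ladder_adj]; omega
      · refine Reaches.single (hcol L le_rfl) hvA ?_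
        rw [ladder_adj]; omega
    exact (hto.trans hlong).trans hfrom

/-- The vertices of level `q` in columns below `k` other than column `c`. -/
def levelErase (k q c : ℕ) : Set (ℕ × ℕ) := {x | x.1 = q ∧ x.2 < k ∧ x.2 ≠ c}

theorem levelErase_eq (k q c : ℕ) :
    levelErase k q c = ↑(((Finset.range k).erase c).image (Prod.mk q)) := by
  ext ⟨a, b⟩
  simp only [levelErase, Set.mem_ofPred_eq, Finset.coe_image, Set.mem_image, Finset.mem_coe,
    Finset.mem_erase, Finset.mem_range, Prod.mk.injEq]
  constructor
  · rintro ⟨rfl, hb, hbc⟩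
    exact ⟨b, ⟨hbc, hb⟩, rfl, rfl⟩
  · rintro ⟨_, ⟨hbc, hb⟩, rfl, rfl⟩
    exact ⟨rfl, hb, hbc⟩

theorem finite_levelErase (k q c : ℕ) : (levelErase k q c).Finite := by
  rw [levelErase_eq]
  exact Finset.finite_toSet _

theorem ncard_levelErase_lt {k c : ℕ} (q : ℕ) (hc : c < k) : (levelErase k q c).ncard < k := by
  rw [levelErase_eq, Set.ncard_coe_finset]
  refine Finset.card_image_le.trans_lt ?_
  rw [Finset.card_erase_of_mem (by simpa using hc), Finset.card_range]
  omega

theorem exists_level_zero {L k : ℕ} (hL : 6 ≤ L) (hk : 2 ≤ k) {W : Set (ℕ × ℕ)}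
    (hW : W ⊆ ladderVerts L k) (h : (ladder L).StronglyConnOn W k) : ∃ x ∈ W, x.1 = 0 := by
  have hfin := (finite_ladderVerts L k).subset hW
  have hne : W.Nonempty := Set.nonempty_of_ncard_ne_zero (by have := h.1; omega)
  obtain ⟨m, hm, hmin⟩ := Set.exists_min_image W toLex hfin hne
  simp only [Prod.Lex.toLex_le_toLex] at hmin
  refine ⟨m, hm, ?_⟩
  by_contra h0
  by_cases h2 : m.1 + 2 = L
  · obtain ⟨z, ⟨hz, hzL⟩, hmax⟩ := Set.exists_max_image {z ∈ W | z.1 + 2 = L} Prod.snd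
      (hfin.subset fun z hz => hz.1) ⟨m, hm, h2⟩
    obtain ⟨y, hy, hyS, hyz⟩ := h.exists_in (finite_levelErase k (L - 1) z.2)
      (ncard_levelErase_lt _ (hW hz).2) hz (by simp [levelErase])
    have h3 := hmin y hy
    have h4 : y.1 + 2 = L → y.2 ≤ z.2 := fun h => hmax y ⟨hy, h⟩
    have h5 := hW hy
    simp only [levelErase, ladderVerts, Set.mem_ofPred_eq, ladder, LadderUp] at *
    omega
  · obtain ⟨y, hy, hyS, hyz⟩ := h.exists_out (S := {(m.1 + 1, m.2)}) (Set.finite_singleton _)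
      (by rw [Set.ncard_singleton]; omega) hm (by simp [Prod.ext_iff])
    have h3 := hmin y hy
    simp only [Set.mem_singleton_iff, Prod.ext_iff, ladder, LadderUp] at *
    omega

theorem exists_level_last {L k : ℕ} (hL : 6 ≤ L) (hk : 2 ≤ k) {W : Set (ℕ × ℕ)}
    (hW : W ⊆ ladderVerts L k) (h : (ladder L).StronglyConnOn W k) : ∃ x ∈ W, x.1 = L := by
  have hfin := (finite_ladderVerts L k).subset hW
  have hne : W.Nonempty := Set.nonempty_of_ncard_ne_zero (by have := h.1; omega)
  obtain ⟨m, hm, hmax⟩ := Set.exists_max_image W toLex hfin hne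
  simp only [Prod.Lex.toLex_le_toLex] at hmax
  refine ⟨m, hm, ?_⟩
  by_contra h0
  by_cases h2 : m.1 = 2
  · obtain ⟨z, ⟨hz, hzL⟩, hmin⟩ := Set.exists_min_image {z ∈ W | z.1 = 2} Prod.snd
      (hfin.subset fun z hz => hz.1) ⟨m, hm, h2⟩
    obtain ⟨y, hy, hyS, hyz⟩ := h.exists_out (finite_levelErase k 1 z.2)
      (ncard_levelErase_lt _ (hW hz).2) hz (by simp [levelErase])
    have h3 := hmax y hy
    have h4 : y.1 = 2 → z.2 ≤ y.2 := fun h => hmin y ⟨hy, h⟩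
    have h5 := hW hy
    simp only [levelErase, ladderVerts, Set.mem_ofPred_eq, ladder, LadderUp] at *
    omega
  · by_cases h1 : m.1 = 0
    · obtain ⟨y, hy, hyS, hyz⟩ := h.exists_in (S := ∅) Set.finite_empty
        (by rw [Set.ncard_empty]; omega) hm (by simp)
      have h3 := hmax y hy
      simp only [ladder, LadderUp] at *
      omega
    obtain ⟨y, hy, hyS, hyz⟩ := h.exists_in (S := {(m.1 - 1, m.2)}) (Set.finite_singleton _)
      (by rw [Set.ncard_singleton]; omega) hm
      (by rw [Set.mem_singleton_iff, Prod.ext_iff]; dsimp only; omega)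
    have h3 := hmax y hy
    simp only [Set.mem_singleton_iff, Prod.ext_iff, ladder, LadderUp] at *
    omega

/-- A strongly `k`-connected part of the ladder meets every middle level in column `0`. -/
theorem mem_of_stronglyConnOn_ladder {L k : ℕ} (hL : 6 ≤ L) (hk : 2 ≤ k) {W : Set (ℕ × ℕ)}
    (hW : W ⊆ ladderVerts L k) (h : (ladder L).StronglyConnOn W k) {q : ℕ} (hq : 2 ≤ q)
    (hqL : q + 3 ≤ L) : (q, 0) ∈ W := by
  obtain ⟨u, hu, hu0⟩ := exists_level_zero hL hk hW h
  obtain ⟨v, hv, hvL⟩ := exists_level_last hL hk hW h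
  obtain ⟨a, ⟨ha, haS⟩, b, -, haX, hbX, hab⟩ := h.exists_adj (S := levelErase k q 0 ∩ W)
    (X := {x | x.1 ≤ q}) Set.inter_subset_right
    ((Set.ncard_le_ncard Set.inter_subset_left (finite_levelErase k q 0)).trans_lt
      (ncard_levelErase_lt q (by omega))) hu
    (by simp only [levelErase, Set.mem_inter_iff, Set.mem_ofPred_eq]; omega)
    (by simp only [Set.mem_ofPred_eq]; omega) hv
    (by simp only [levelErase, Set.mem_inter_iff, Set.mem_ofPred_eq]; omega)
    (by simp only [Set.mem_ofPred_eq]; omega)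
  have hak := (hW ha).2
  have haS' : a ∉ levelErase k q 0 := fun h => haS ⟨h, ha⟩
  obtain rfl : a = (q, 0) := by
    simp only [levelErase, Set.mem_ofPred_eq, ladder, LadderUp, Prod.ext_iff] at *
    omega
  exact ha

theorem lt_ncard_of_stronglyConnOn_ladder {N k : ℕ} (hk : 2 ≤ k) {W : Set (ℕ × ℕ)}
    (hW : W ⊆ ladderVerts (N + 6) k) (h : (ladder (N + 6)).StronglyConnOn W k) :
    N < W.ncard := by
  have hsub : (↑((Finset.Icc 2 (N + 3)).image fun q => (q, 0)) : Set (ℕ × ℕ)) ⊆ W := by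
    intro x hx
    obtain ⟨q, hq, rfl⟩ : ∃ q, (2 ≤ q ∧ q ≤ N + 3) ∧ (q, 0) = x := by simpa using hx
    exact mem_of_stronglyConnOn_ladder (by omega) hk hW h hq.1 (by omega)
  have hc := Set.ncard_le_ncard hsub ((finite_ladderVerts _ k).subset hW)
  rw [Set.ncard_coe_finset, Finset.card_image_of_injective _ (Prod.mk_left_injective 0),
    Nat.card_Icc] at hc
  omega

end Digr

/-- **Corollary 1.3.** For every `k ≥ 2` there are infinitely many minimally strongly
`k`-connected tournaments: for every `N` there is a minimally strongly `k`-connected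
tournament on more than `N` vertices. -/
theorem stmt3 (k : ℕ) (hk : 2 ≤ k) (N : ℕ) :
    ∃ n : ℕ, N < n ∧ ∃ T : Digr (Fin n), T.IsTournament ∧
      T.StronglyConnOn Set.univ k ∧
      ∀ W : Set (Fin n), W ≠ Set.univ → ¬ T.StronglyConnOn W k := by
  exact exists_minimal_tournament (isTournament_ladder (N + 6)) (finite_ladderVerts (N + 6) k)
    (stronglyConnOn_ladder (by omega) hk) fun _ => lt_ncard_of_stronglyConnOn_ladder hk
end
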